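/- Let A ∈ ℤ^{m×n} be an integer matrix with rank n, no singular n×n submatrix, and all n×n sub-determinants bounded in absolute value by δ, where A is in the Hermite-Normal-Form-based shape (8) with at most k ≤ log₂δ non-unit diagonal entries and all entries bounded by C(δ). If n > (2C(δ)+1)^{log₂δ+3} + log₂δ, then m ≤ n+1. -/

import Mathlib

/-- The two-row instance of Jacobi's identity for complementary minors. -/
theorem det_mul_det_updateRow_updateRow {ι R : Type*} [Fintype ι] [DecidableEq ι] [CommRing R]
    (M : Matrix ι ι R) (r s : ι → R) {i j : ι} (hij : i ≠ j) :
    M.det * ((M.updateRow i r).updateRow j s).det =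
      (M.updateRow i r).det * (M.updateRow j s).det -
        (M.updateRow j r).det * (M.updateRow i s).det := by
  set N := M.updateRow i r with hN
  have hs : M.det • s = ∑ l, (M.updateRow l s).det • M l := by
    have h := Matrix.mulVec_cramer M.transpose s
    rw [Matrix.det_transpose] at h
    rw [← h]
    ext k
    simp [Matrix.mulVec, dotProduct, Matrix.cramer_transpose_apply, mul_comm]
  have hexp : M.det * (N.updateRow j s).det =
      ∑ l, (M.updateRow l s).det * (N.updateRow j (M l)).det := by
    have h := congrFun (congrArg (Matrix.cramer N.transpose) hs) j
    simp only [map_smul, map_sum, Pi.smul_apply, Finset.sum_apply, smul_eq_mul] at h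
    simpa only [Matrix.cramer_transpose_apply] using h
  have hi : (N.updateRow j (M i)).det = -(M.updateRow j r).det := by
    have hswap : N.updateRow j (M i) = (M.updateRow j r).submatrix (Equiv.swap i j) id := by
      ext a k
      rcases eq_or_ne a j with rfl | haj
      · simp [Matrix.updateRow_ne hij]
      rcases eq_or_ne a i with rfl | hai
      · simp [hN, Matrix.updateRow_ne haj]
      · simp [hN, Matrix.updateRow_ne haj, Matrix.updateRow_ne hai,
          Equiv.swap_apply_of_ne_of_ne hai haj]
    rw [hswap, Matrix.det_permute, Equiv.Perm.sign_swap hij]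
    simp
  have hj : N.updateRow j (M j) = N := by
    rw [← Matrix.updateRow_ne (M := M) (b := r) hij.symm]
    exact Matrix.updateRow_eq_self N j
  rw [hexp, Finset.sum_eq_add i j hij, hi, hj]
  · ring
  · rintro l - ⟨hli, hlj⟩
    have hl : (N.updateRow j (M l)).det = 0 := by
      refine Matrix.det_zero_of_row_eq hlj ?_
      rw [Matrix.updateRow_ne hlj, Matrix.updateRow_self, hN, Matrix.updateRow_ne hli]
    rw [hl, mul_zero]
  · simp
  · simp

/-- A family of distinct points of `[-D, D]²` which is isotropic modulo `D` has at most `9 * D`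
members. -/
theorem card_le_of_dvd_minors {ι : Type*} [Fintype ι] {D : ℤ} (hD : 0 < D) (a b : ι → ℤ)
    (ha : ∀ i, |a i| ≤ D) (hb : ∀ i, |b i| ≤ D)
    (hdvd : ∀ i j, D ∣ a i * b j - a j * b i)
    (hinj : ∀ i j, a i = a j → b i = b j → i = j) :
    (Fintype.card ι : ℤ) ≤ 9 * D := by
  let I : Ideal ℤ :=
    { carrier := {x | ∃ t, ∀ i, D ∣ x * b i - t * a i}
      zero_mem' := ⟨0, fun i => by simp⟩
      add_mem' := by
        rintro x y ⟨t, ht⟩ ⟨u, hu⟩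
        refine ⟨t + u, fun i => ?_⟩
        rw [show (x + y) * b i - (t + u) * a i = x * b i - t * a i + (y * b i - u * a i) by ring]
        exact dvd_add (ht i) (hu i)
      smul_mem' := by
        rintro c x ⟨t, ht⟩
        refine ⟨c * t, fun i => ?_⟩
        rw [smul_eq_mul, show c * x * b i - c * t * a i = c * (x * b i - t * a i) by ring]
        exact (ht i).mul_left c }
  obtain ⟨g, hg, hg0⟩ : ∃ g : ℤ, I = Ideal.span {g} ∧ 0 ≤ g := by
    obtain ⟨g, hg⟩ := (IsPrincipalIdealRing.principal I).principal
    refine ⟨|g|, ?_, abs_nonneg g⟩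
    rw [hg, Ideal.submodule_span_eq, Ideal.span_singleton_eq_span_singleton]
    exact Int.associated_iff_natAbs.2 (Int.natAbs_abs g).symm
  have hmem : ∀ x, x ∈ I ↔ g ∣ x := fun x => by rw [hg, Ideal.mem_span_singleton]
  obtain ⟨q, hq⟩ : g ∣ D := (hmem D).1 ⟨0, fun i => by simp⟩
  have hga : ∀ i, g ∣ a i := fun j => (hmem _).1 ⟨b j, fun i => by
    rw [mul_comm (b j)]
    exact hdvd j i⟩
  obtain ⟨t, ht⟩ : g ∈ I := (hmem g).2 dvd_rfl
  have hgpos : 0 < g := lt_of_le_of_ne hg0 (by rintro rfl; simp at hq; omega)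
  have hqpos : 0 < q := pos_of_mul_pos_right (hq ▸ hD) hg0
  have hmaps : ∀ i ∈ (Finset.univ : Finset ι), (a i / g, b i / q) ∈
      Finset.Icc (-q) q ×ˢ Finset.Icc (-g) g := by
    intro i _
    obtain ⟨ha1, ha2⟩ := abs_le.1 (ha i)
    obtain ⟨hb1, hb2⟩ := abs_le.1 (hb i)
    simp only [Finset.mem_product, Finset.mem_Icc]
    refine ⟨⟨?_, ?_⟩, ?_, ?_⟩
    · rw [Int.le_ediv_iff_mul_le hgpos]; nlinarith
    · exact Int.ediv_le_of_le_mul hgpos (by nlinarith)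
    · rw [Int.le_ediv_iff_mul_le hqpos]; nlinarith
    · exact Int.ediv_le_of_le_mul hqpos (by nlinarith)
  have hinjOn : Set.InjOn (fun i => (a i / g, b i / q)) (Finset.univ : Finset ι) := by
    intro i _ j _ hij
    obtain ⟨h1, h2⟩ := Prod.mk.inj hij
    have haij : a i = a j := by
      rw [← Int.ediv_mul_cancel (hga i), ← Int.ediv_mul_cancel (hga j), h1]
    refine hinj i j haij ?_
    have hqb : q ∣ b i - b j := by
      have h := dvd_sub (ht i) (ht j)
      rw [haij, hq] at h
      refine (mul_dvd_mul_iff_left hgpos.ne').1 (h.trans (dvd_of_eq ?_))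
      ring
    have hmod : b i % q = b j % q := Int.emod_eq_emod_iff_emod_sub_eq_zero.2 (Int.emod_eq_zero_of_dvd hqb)
    rw [← Int.emod_add_mul_ediv (b i) q, ← Int.emod_add_mul_ediv (b j) q, hmod, h2]
  have hcard := Finset.card_le_card_of_injOn _ hmaps hinjOn
  rw [Finset.card_univ, Finset.card_product, Int.card_Icc, Int.card_Icc] at hcard
  zify at hcard
  rw [Int.toNat_of_nonneg (by omega), Int.toNat_of_nonneg (by omega)] at hcard
  rw [hq]
  nlinarith

/-- If all maximal minors of an integer matrix with at least two more rows than columns are nonzero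
and at most `δ` in absolute value, then it has at most `9 * δ` columns. -/
theorem card_columns_le_of_det_submatrix_ne_zero {m n : ℕ} {δ : ℤ} (hmn : n + 2 ≤ m)
    (A : Matrix (Fin m) (Fin n) ℤ)
    (hsub : ∀ f : Fin n → Fin m, Function.Injective f →
      (A.submatrix f id).det ≠ 0 ∧ |(A.submatrix f id).det| ≤ δ) :
    (n : ℤ) ≤ 9 * δ := by
  have : Nonempty (Fin n ↪ Fin m) := ⟨Fin.castLEEmb (by omega)⟩
  obtain ⟨f, hf⟩ := Finite.exists_max fun f : Fin n ↪ Fin m => |(A.submatrix f id).det|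
  set M := A.submatrix f id with hM
  obtain ⟨r, hr, s, hs, hrs⟩ : ∃ r ∈ (Finset.univ.map f)ᶜ, ∃ s ∈ (Finset.univ.map f)ᶜ, r ≠ s := by
    rw [← Finset.one_lt_card, Finset.card_compl]
    simp
    omega
  replace hr : ∀ k, f k ≠ r := by simpa using hr
  replace hs : ∀ k, f k ≠ s := by simpa using hs
  have hupd : ∀ (h : Fin n → Fin m) (i : Fin n) (x : Fin m),
      A.submatrix (Function.update h i x) id = (A.submatrix h id).updateRow i (A x) := by
    intro h i x
    ext k l
    rcases eq_or_ne k i with rfl | hki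
    · simp
    · simp [hki]
  have hinj : ∀ (h : Fin n → Fin m), Function.Injective h → ∀ (i : Fin n) (x : Fin m),
      (∀ k, h k ≠ x) → Function.Injective (Function.update h i x) := by
    intro h hh i x hx k l hkl
    by_cases hk : k = i <;> by_cases hl : l = i
    · rw [hk, hl]
    · subst hk
      simp [hl] at hkl
      exact absurd hkl.symm (hx l)
    · subst hl
      simp [hk] at hkl
      exact absurd hkl (hx k)
    · simp [hk, hl] at hkl
      exact hh hkl
  have hle : ∀ x, (∀ k, f k ≠ x) → ∀ i, |(M.updateRow i (A x)).det| ≤ |M.det| := by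
    intro x hx i
    rw [hM, ← hupd]
    exact hf ⟨_, hinj f f.injective i x hx⟩
  have hne : ∀ i j, i ≠ j → ((M.updateRow i (A r)).updateRow j (A s)).det ≠ 0 := by
    intro i j hij
    rw [hM, ← hupd, ← hupd]
    refine (hsub _ (hinj _ (hinj f f.injective i r hr) j s fun k => ?_)).1
    by_cases hk : k = i
    · simpa [hk] using hrs
    · simpa [hk] using hs k
  obtain ⟨hM0, hMδ⟩ := hsub f f.injective
  have hcard := card_le_of_dvd_minors (abs_pos.2 hM0) (fun i => (M.updateRow i (A r)).det)
    (fun i => (M.updateRow i (A s)).det) (hle r hr) (hle s hs)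
    (fun i j => by
      rw [abs_dvd]
      rcases eq_or_ne i j with rfl | hij
      · simp
      · exact ⟨_, (det_mul_det_updateRow_updateRow M (A r) (A s) hij).symm⟩)
    (fun i j hr hs => by
      by_contra hij
      have h := det_mul_det_updateRow_updateRow M (A r) (A s) hij
      rw [hr, hs, sub_self] at h
      exact mul_ne_zero hM0 (hne i j hij) h)
  rw [Fintype.card_fin] at hcard
  linarith


/-- Lemma 7: if `A ∈ ℤ^{m×n}` is in the HNF-based shape (8), has rank `n`, no singular
`n × n` submatrix, all `n × n` sub-determinants bounded by `δ`, at most `log₂ δ` non-unit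
diagonal entries, all entries bounded by `C`, and `n > (2C+1)^{log₂ δ + 3} + log₂ δ`,
then `A` has at most `n + 1` rows. -/
theorem rows_at_most_n_plus_one (m n : ℕ) (δ C : ℕ) (hδ : 1 ≤ δ)
    (hmn : n ≤ m)
    (A : Matrix (Fin m) (Fin n) ℤ)
    (hrank : (A.map (Int.cast : ℤ → ℚ)).rank = n)
    (htri : ∀ i j : Fin n, i < j → A (Fin.castLE hmn i) j = 0)
    (hdiagpos : ∀ i : Fin n, 1 ≤ A (Fin.castLE hmn i) i)
    (hk : ((Finset.univ.filter
        (fun i : Fin n => 1 < A (Fin.castLE hmn i) i)).card : ℝ) ≤ Real.logb 2 δ)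
    (hsub : ∀ f : Fin n → Fin m, Function.Injective f →
      (A.submatrix f id).det ≠ 0 ∧ |(A.submatrix f id).det| ≤ (δ : ℤ))
    (hC : ∀ i j, |A i j| ≤ (C : ℤ))
    (hn : ((2 * C + 1 : ℕ) : ℝ) ^ (Real.logb 2 δ + 3) + Real.logb 2 δ < (n : ℝ)) :
    m ≤ n + 1 := by
  by_contra! hm
  have hlog : 0 ≤ Real.logb 2 (δ : ℝ) := Real.logb_nonneg one_lt_two (by exact_mod_cast hδ)
  have hn0 : 0 < n := by
    have h : (0 : ℝ) < n := lt_of_le_of_lt (by positivity) hn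
    exact_mod_cast h
  have hC1 : (1 : ℤ) ≤ C := (hdiagpos ⟨0, hn0⟩).trans ((le_abs_self _).trans (hC _ _))
  have hbase : (3 : ℝ) ≤ ((2 * C + 1 : ℕ) : ℝ) := by
    exact_mod_cast (by omega : 3 ≤ 2 * C + 1)
  have hpow : 27 * (δ : ℝ) ≤ ((2 * C + 1 : ℕ) : ℝ) ^ (Real.logb 2 δ + 3) :=
    calc 27 * (δ : ℝ) = 2 ^ Real.logb 2 (δ : ℝ) * 27 := by
          rw [Real.rpow_logb two_pos (by norm_num) (by exact_mod_cast hδ), mul_comm]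
      _ ≤ 3 ^ Real.logb 2 (δ : ℝ) * 27 := by gcongr; norm_num
      _ = 3 ^ (Real.logb 2 (δ : ℝ) + 3) := by
          rw [Real.rpow_add (by norm_num)]
          norm_num
      _ ≤ _ := by gcongr
  have hcol : (n : ℝ) ≤ 9 * δ := by
    exact_mod_cast card_columns_le_of_det_submatrix_ne_zero (by omega) A hsub
  have hδ0 : (0 : ℝ) < δ := by exact_mod_cast hδ
  linarith
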